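/- arXiv:1608.08890 — 2 statements merged into one kernel-verified Lean document; each statement's English description precedes it below -/
import Mathlib

section
/- Let a₂₂, a₅₀, b₁₃, b₄₁ be real numbers. Define f₂(θ) = ∫₀^θ cos⁷φ·sin²φ·(2cos²φ + 3sin²φ)·(cos⁶φ + sin⁴φ)^{−25/12} dφ and g₂(θ) = ∫₀^θ cos¹⁰φ·(2cos²φ + 3sin²φ)·(cos⁶φ + sin⁴φ)^{−25/12} dφ. Then the function u₂(θ) := −cos²θ·sin θ·(2b₄₁cos³θ + 5b₁₃sin²θ)/(60·(cos⁶θ + sin⁴θ)^{13/12}) + (1/24)·(2a₂₂ + 3b₁₃)·f₂(θ) + (1/60)·(5a₅₀ + b₄₁)·g₂(θ) satisfies u₂(0) = 0 and, for all real θ, u₂′(θ) = cos θ·(2cos²θ + 3sin²θ)·(3a₅₀cos⁹θ + 3a₂₂cos⁶θ·sin²θ + 2b₄₁cos³θ·sin⁴θ + 2b₁₃sin⁶θ) / (36·(cos⁶θ + sin⁴θ)^{25/12}). -/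
open Real

/-- the explicit function `u₂` built from the integrals `f₂, g₂`
satisfies `u₂(0) = 0` and the linear differential equation for the second
coefficient of the 2:3 homogeneous weight system. -/
theorem u2_formula (a22 a50 b13 b41 : ℝ)
    (f2 g2 : ℝ → ℝ)
    (hf2 : ∀ θ : ℝ, f2 θ =
      ∫ φ in (0:ℝ)..θ, Real.cos φ ^ 7 * Real.sin φ ^ 2 *
        (2 * Real.cos φ ^ 2 + 3 * Real.sin φ ^ 2) *
        (Real.cos φ ^ 6 + Real.sin φ ^ 4) ^ (-(25 : ℝ) / 12))
    (hg2 : ∀ θ : ℝ, g2 θ =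
      ∫ φ in (0:ℝ)..θ, Real.cos φ ^ 10 *
        (2 * Real.cos φ ^ 2 + 3 * Real.sin φ ^ 2) *
        (Real.cos φ ^ 6 + Real.sin φ ^ 4) ^ (-(25 : ℝ) / 12))
    (u2 : ℝ → ℝ)
    (hu2 : ∀ θ : ℝ, u2 θ =
      -(Real.cos θ ^ 2 * Real.sin θ * (2 * b41 * Real.cos θ ^ 3 + 5 * b13 * Real.sin θ ^ 2)) /
        (60 * (Real.cos θ ^ 6 + Real.sin θ ^ 4) ^ ((13 : ℝ) / 12)) +
      (1 / 24) * (2 * a22 + 3 * b13) * f2 θ +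
      (1 / 60) * (5 * a50 + b41) * g2 θ) :
    u2 0 = 0 ∧
    ∀ θ : ℝ, HasDerivAt u2
      (Real.cos θ * (2 * Real.cos θ ^ 2 + 3 * Real.sin θ ^ 2) *
        (3 * a50 * Real.cos θ ^ 9 + 3 * a22 * Real.cos θ ^ 6 * Real.sin θ ^ 2 +
          2 * b41 * Real.cos θ ^ 3 * Real.sin θ ^ 4 + 2 * b13 * Real.sin θ ^ 6) /
        (36 * (Real.cos θ ^ 6 + Real.sin θ ^ 4) ^ ((25 : ℝ) / 12))) θ := by
  have hD : ∀ θ : ℝ, 0 < Real.cos θ ^ 6 + Real.sin θ ^ 4 := by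
    intro θ
    have h1 := Real.sin_sq_add_cos_sq θ
    by_cases hs : Real.sin θ = 0
    · have hc : Real.cos θ ≠ 0 := by
        intro hc
        rw [hs, hc] at h1
        norm_num at h1
      have : 0 < Real.cos θ ^ 6 := by positivity
      positivity
    · have : 0 < Real.sin θ ^ 4 := by positivity
      positivity
  have hcont : Continuous fun φ : ℝ =>
      (Real.cos φ ^ 6 + Real.sin φ ^ 4) ^ (-(25 : ℝ) / 12) := by
    refine Continuous.rpow_const (by fun_prop) ?_
    intro x
    exact Or.inl (hD x).ne'
  constructor
  · rw [hu2, hf2, hg2]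
    simp
  intro θ
  have hf : HasDerivAt f2 (Real.cos θ ^ 7 * Real.sin θ ^ 2 *
        (2 * Real.cos θ ^ 2 + 3 * Real.sin θ ^ 2) *
        (Real.cos θ ^ 6 + Real.sin θ ^ 4) ^ (-(25 : ℝ) / 12)) θ := by
    rw [funext hf2]
    exact intervalIntegral.integral_hasDerivAt_right (Continuous.intervalIntegrable (by fun_prop) _ _)
      (Continuous.stronglyMeasurableAtFilter (by fun_prop) _ _) (Continuous.continuousAt (by fun_prop))
  have hg : HasDerivAt g2 (Real.cos θ ^ 10 *
        (2 * Real.cos θ ^ 2 + 3 * Real.sin θ ^ 2) *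
        (Real.cos θ ^ 6 + Real.sin θ ^ 4) ^ (-(25 : ℝ) / 12)) θ := by
    rw [funext hg2]
    exact intervalIntegral.integral_hasDerivAt_right (Continuous.intervalIntegrable (by fun_prop) _ _)
      (Continuous.stronglyMeasurableAtFilter (by fun_prop) _ _) (Continuous.continuousAt (by fun_prop))
  have hc := Real.hasDerivAt_cos θ
  have hs := Real.hasDerivAt_sin θ
  have hP := ((hc.pow 6).add (hs.pow 4)).rpow_const (p := (13 : ℝ) / 12) (Or.inl (hD θ).ne')
  have hN := (((hc.pow 2).mul hs).mul
    (((hc.pow 3).const_mul (2 * b41)).add ((hs.pow 2).const_mul (5 * b13)))).neg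
  have hQ := hN.div (hP.const_mul 60) (by
    have := Real.rpow_pos_of_pos (hD θ) ((13 : ℝ) / 12)
    simp only [Pi.add_apply, Pi.pow_apply]
    positivity)
  have hU := (hQ.add (hf.const_mul ((1 / 24) * (2 * a22 + 3 * b13)))).add
    (hg.const_mul ((1 / 60) * (5 * a50 + b41)))
  rw [funext hu2]
  refine hU.congr_deriv ?_
  simp only [Pi.add_apply, Pi.pow_apply, Pi.mul_apply, Pi.neg_apply]
  have h1 : Real.sin θ ^ 2 = 1 - Real.cos θ ^ 2 := by
    have := Real.sin_sq_add_cos_sq θ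
    linarith
  have hDθ := hD θ
  generalize hDe : Real.cos θ ^ 6 + Real.sin θ ^ 4 = D at hDθ ⊢
  have e1 : D ^ ((13 : ℝ) / 12 - 1) = D ^ ((1 : ℝ) / 12) := by norm_num
  have e2 : D ^ ((13 : ℝ) / 12) = D * D ^ ((1 : ℝ) / 12) := by
    rw [show (13 : ℝ) / 12 = 1 + 1 / 12 by norm_num, Real.rpow_add hDθ, Real.rpow_one]
  have e3 : D ^ ((25 : ℝ) / 12) = D ^ 2 * D ^ ((1 : ℝ) / 12) := by
    rw [show (25 : ℝ) / 12 = (2 : ℕ) + 1 / 12 by norm_num, Real.rpow_add hDθ, Real.rpow_natCast]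
  have e4 : D ^ (-(25 : ℝ) / 12) = (D ^ 2 * D ^ ((1 : ℝ) / 12))⁻¹ := by
    rw [neg_div, Real.rpow_neg hDθ.le, e3]
  rw [e1, e2, e3, e4]
  have hE : 0 < D ^ ((1 : ℝ) / 12) := Real.rpow_pos_of_pos hDθ _
  generalize D ^ ((1 : ℝ) / 12) = E at hE ⊢
  have hD0 := hDθ.ne'
  have hE0 := hE.ne'
  generalize Real.cos θ = c at *
  generalize Real.sin θ = s at *
  field_simp
  subst hDe
  ring
end

section
/- Define f₂(φ) = ∫₀^φ cos⁷ψ·sin²ψ·(2cos²ψ + 3sin²ψ)·(cos⁶ψ + sin⁴ψ)^{−25/12} dψ, A = ∫₀^{2π} cos³⁶φ·(2cos²φ + 3sin²φ)·(cos⁶φ + sin⁴φ)^{−77/12} dφ, and B = ∫₀^{2π} cos²⁸φ·sin φ·(2cos²φ + 3sin²φ)·(cos⁶φ + sin⁴φ)^{−16/3}·f₂(φ) dφ. Then 575803·A − 11848200·B > 0. -/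
open Real

namespace FocalAux

/-- `H = cos^6 + sin^4`. -/
noncomputable def H (t : ℝ) : ℝ := Real.cos t ^ 6 + Real.sin t ^ 4

/-- `r = H^(-1/12)`. -/
noncomputable def r (t : ℝ) : ℝ := (H t) ^ (-(1 : ℝ) / 12)

/-- the weight `2cos² + 3sin²`. -/
noncomputable def w (t : ℝ) : ℝ := 2 * Real.cos t ^ 2 + 3 * Real.sin t ^ 2

lemma H_pos (t : ℝ) : 0 < H t := by
  unfold H
  have h := Real.sin_sq_add_cos_sq t
  rcases eq_or_ne (Real.sin t) 0 with hs | hs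
  · have hc : Real.cos t ^ 2 = 1 := by rw [hs] at h; linarith
    have : Real.cos t ^ 6 = 1 := by
      calc Real.cos t ^ 6 = (Real.cos t ^ 2) ^ 3 := by ring
        _ = 1 := by rw [hc]; norm_num
    rw [this]; positivity
  · positivity

lemma r_pos (t : ℝ) : 0 < r t := Real.rpow_pos_of_pos (H_pos t) _

lemma w_nonneg (t : ℝ) : 0 ≤ w t := by unfold w; positivity

lemma rpow_eq (t : ℝ) (n : ℕ) (e : ℝ) (he : e = (-(1 : ℝ) / 12) * n) :
    (Real.cos t ^ 6 + Real.sin t ^ 4) ^ e = r t ^ n := by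
  change H t ^ e = _
  unfold r
  rw [he, Real.rpow_mul (H_pos t).le, Real.rpow_natCast]

lemma r_H (t : ℝ) : r t ^ 12 * H t = 1 := by
  have h : (H t) ^ (-1 : ℝ) = r t ^ 12 := rpow_eq t 12 (-1) (by norm_num)
  rw [← h, Real.rpow_neg_one]
  exact inv_mul_cancel₀ (H_pos t).ne'

lemma hasDerivAt_H (t : ℝ) : HasDerivAt H
    (-6 * Real.cos t ^ 5 * Real.sin t + 4 * Real.sin t ^ 3 * Real.cos t) t := by
  have := ((Real.hasDerivAt_cos t).pow 6).add ((Real.hasDerivAt_sin t).pow 4)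
  refine HasDerivAt.congr_deriv (f := H) this ?_
  norm_num

lemma hasDerivAt_r (t : ℝ) : HasDerivAt r
    (-(1 / 12) * (-6 * Real.cos t ^ 5 * Real.sin t + 4 * Real.sin t ^ 3 * Real.cos t)
      * r t ^ 13) t := by
  have h1 := (hasDerivAt_H t).rpow_const (p := -(1 : ℝ) / 12) (Or.inl (H_pos t).ne')
  refine HasDerivAt.congr_deriv (f := r) h1 ?_
  have h2 : H t ^ (-(1 : ℝ) / 12 - 1) = r t ^ 13 := rpow_eq t 13 _ (by norm_num)
  rw [h2]; ring

lemma cont_r : Continuous r :=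
  continuous_iff_continuousAt.2 fun t => (hasDerivAt_r t).continuousAt

lemma cont_w : Continuous w := by unfold w; fun_prop

/-- `x = cos * r^2`. -/
noncomputable def x (t : ℝ) : ℝ := Real.cos t * r t ^ 2

/-- `y = sin * r^3`. -/
noncomputable def y (t : ℝ) : ℝ := Real.sin t * r t ^ 3

lemma xy (t : ℝ) : x t ^ 6 + y t ^ 4 = 1 := by
  have := r_H t
  unfold H at this
  unfold x y
  linear_combination this

lemma hasDerivAt_x (t : ℝ) : HasDerivAt x
    (-(1 / 3) * Real.sin t ^ 3 * r t ^ 14 * w t) t := by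
  have := (Real.hasDerivAt_cos t).mul ((hasDerivAt_r t).pow 2)
  refine HasDerivAt.congr_deriv (f := x) this ?_
  have h := r_H t
  unfold H at h
  unfold w
  simp only [Pi.pow_apply]
  norm_num
  linear_combination (Real.sin t * r t ^ 2) * h

lemma hasDerivAt_y (t : ℝ) : HasDerivAt y
    ((1 / 2) * Real.cos t ^ 5 * r t ^ 15 * w t) t := by
  have := (Real.hasDerivAt_sin t).mul ((hasDerivAt_r t).pow 3)
  refine HasDerivAt.congr_deriv (f := y) this ?_
  have h := r_H t
  unfold H at h
  unfold w
  simp only [Pi.pow_apply]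
  norm_num
  linear_combination (-Real.cos t * r t ^ 3) * h

lemma x_sq_le (t : ℝ) : x t ^ 2 ≤ 1 := by
  have h := xy t
  by_contra hc
  push Not at hc
  have h2 : 1 < (x t ^ 2) ^ 3 := one_lt_pow₀ hc (by norm_num)
  have h3 : 0 ≤ y t ^ 4 := by positivity
  nlinarith

/-- integrand of `f₂`. -/
noncomputable def k (t : ℝ) : ℝ := Real.cos t ^ 7 * Real.sin t ^ 2 * w t * r t ^ 25

lemma cont_k : Continuous k := by
  unfold k
  have := cont_r
  have := cont_w
  fun_prop

/-- `f₂`. -/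
noncomputable def F (t : ℝ) : ℝ := ∫ s in (0 : ℝ)..t, k s

lemma hasDerivAt_F (t : ℝ) : HasDerivAt F (k t) t :=
  intervalIntegral.integral_hasDerivAt_right (cont_k.intervalIntegrable _ _)
    (cont_k.stronglyMeasurableAtFilter _ _) cont_k.continuousAt

lemma k_pi_sub (t : ℝ) : k (π - t) = - k t := by
  unfold k w r H
  rw [Real.cos_pi_sub, Real.sin_pi_sub]
  have h : (-Real.cos t) ^ 6 = Real.cos t ^ 6 := by ring
  rw [h]; ring

lemma k_three_pi_sub (t : ℝ) : k (3 * π - t) = - k t := by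
  rw [← k_pi_sub]
  have e : 3 * π - t = (π - t) + 2 * π := by ring
  unfold k w r H
  rw [e, Real.cos_add_two_pi, Real.sin_add_two_pi]

lemma F_zero : F 0 = 0 := by simp [F]

lemma F_pi : F π = 0 := by
  have h := intervalIntegral.integral_comp_sub_left (a := 0) (b := π) k π
  simp only [k_pi_sub, intervalIntegral.integral_neg, sub_self, sub_zero] at h
  unfold F; linarith

lemma F_two_pi : F (2 * π) = 0 := by
  have h := intervalIntegral.integral_comp_sub_left (a := π) (b := 2 * π) k (3 * π)
  simp only [k_three_pi_sub, intervalIntegral.integral_neg] at h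
  rw [show 3 * π - 2 * π = π by ring, show 3 * π - π = 2 * π by ring] at h
  have h2 := intervalIntegral.integral_add_adjacent_intervals
    (cont_k.intervalIntegrable (μ := MeasureTheory.volume) 0 π)
    (cont_k.intervalIntegrable (μ := MeasureTheory.volume) π (2 * π))
  have h3 := F_pi
  unfold F at h3 ⊢
  linarith

/-- comparison function `(2/3) y³ - f₂`. -/
noncomputable def g (t : ℝ) : ℝ := (2 / 3) * y t ^ 3 - F t

lemma hasDerivAt_g (t : ℝ) : HasDerivAt g
    (Real.cos t * (Real.cos t ^ 4 * r t ^ 15 * w t * y t ^ 2 * (1 - x t ^ 2))) t := by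
  have := (((hasDerivAt_y t).pow 3).const_mul (2 / 3 : ℝ)).sub (hasDerivAt_F t)
  refine HasDerivAt.congr_deriv (f := g) this ?_
  unfold k x y
  norm_num
  ring

lemma g_aux (t : ℝ) : 0 ≤ Real.cos t ^ 4 * r t ^ 15 * w t * y t ^ 2 * (1 - x t ^ 2) := by
  have h1 := x_sq_le t
  have h2 := w_nonneg t
  have h3 := r_pos t
  have h4 : 0 ≤ 1 - x t ^ 2 := by linarith
  positivity

lemma cont_g : Continuous g :=
  continuous_iff_continuousAt.2 fun t => (hasDerivAt_g t).continuousAt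

lemma g_mono {a b : ℝ} (h : ∀ t ∈ Set.Icc a b, 0 ≤ Real.cos t) :
    MonotoneOn g (Set.Icc a b) := by
  refine monotoneOn_of_deriv_nonneg (convex_Icc a b) cont_g.continuousOn
    (fun t _ => (hasDerivAt_g t).differentiableAt.differentiableWithinAt) fun t ht => ?_
  rw [(hasDerivAt_g t).deriv]
  exact mul_nonneg (h t (interior_subset ht)) (g_aux t)

lemma g_anti {a b : ℝ} (h : ∀ t ∈ Set.Icc a b, Real.cos t ≤ 0) :
    AntitoneOn g (Set.Icc a b) := by
  refine antitoneOn_of_deriv_nonpos (convex_Icc a b) cont_g.continuousOn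
    (fun t _ => (hasDerivAt_g t).differentiableAt.differentiableWithinAt) fun t ht => ?_
  rw [(hasDerivAt_g t).deriv]
  exact mul_nonpos_of_nonpos_of_nonneg (h t (interior_subset ht)) (g_aux t)

lemma g_zero : g 0 = 0 := by simp [g, y, F_zero]
lemma g_pi : g π = 0 := by simp [g, y, F_pi]
lemma g_two_pi : g (2 * π) = 0 := by simp [g, y, F_two_pi]

lemma sin_mul_g (t : ℝ) (h0 : 0 ≤ t) (h1 : t ≤ 2 * π) : 0 ≤ Real.sin t * g t := by
  have hp := Real.pi_pos
  rcases le_total t π with hl | hl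
  · have hs : 0 ≤ Real.sin t := Real.sin_nonneg_of_nonneg_of_le_pi h0 hl
    refine mul_nonneg hs ?_
    rcases le_total t (π / 2) with h2 | h2
    · have := g_mono (a := 0) (b := π / 2)
        (fun s hs => Real.cos_nonneg_of_neg_pi_div_two_le_of_le (by linarith [hs.1]) hs.2)
        ⟨le_rfl, by linarith⟩ ⟨h0, h2⟩ h0
      linarith [g_zero]
    · have := g_anti (a := π / 2) (b := π)
        (fun s hs => Real.cos_nonpos_of_pi_div_two_le_of_le hs.1 (by linarith [hs.2]))
        ⟨h2, hl⟩ ⟨by linarith, le_rfl⟩ hl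
      linarith [g_pi]
  · have hs : Real.sin t ≤ 0 := by
      have := Real.sin_nonneg_of_nonneg_of_le_pi (x := t - π) (by linarith) (by linarith)
      rw [Real.sin_sub_pi] at this; linarith
    refine mul_nonneg_of_nonpos_of_nonpos hs ?_
    rcases le_total t (3 * π / 2) with h2 | h2
    · have := g_anti (a := π) (b := 3 * π / 2)
        (fun s hs => Real.cos_nonpos_of_pi_div_two_le_of_le (by linarith [hs.1])
          (by linarith [hs.2]))
        ⟨le_rfl, by linarith⟩ ⟨hl, h2⟩ hl
      linarith [g_pi]
    · have := g_mono (a := 3 * π / 2) (b := 2 * π)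
        (fun s hs => by
          rw [← Real.cos_sub_two_pi]
          exact Real.cos_nonneg_of_neg_pi_div_two_le_of_le (by linarith [hs.1])
            (by linarith [hs.2]))
        ⟨h2, h1⟩ ⟨by linarith, le_rfl⟩ h1
      linarith [g_two_pi]

/-- exact primitive that is subtracted. -/
noncomputable def G (t : ℝ) : ℝ :=
  2 * (11848200 / 29) * (x t ^ 29 * y t) + 2 * (3 * 11848200 / 2030) * (x t ^ 35 * y t)

/-- derivative of `G`. -/
noncomputable def dG (t : ℝ) : ℝ :=
  Real.cos t ^ 5 * r t ^ 15 * w t *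
    ((11848200 / 29) * (x t ^ 29 - 58 / 3 * x t ^ 23 * y t ^ 4)
      + (3 * 11848200 / 2030) * (x t ^ 35 - 70 / 3 * x t ^ 29 * y t ^ 4))

lemma hasDerivAt_G (t : ℝ) : HasDerivAt G (dG t) t := by
  have h1 := (((hasDerivAt_x t).pow 29).mul (hasDerivAt_y t)).const_mul
    (2 * (11848200 / 29) : ℝ)
  have h2 := (((hasDerivAt_x t).pow 35).mul (hasDerivAt_y t)).const_mul
    (2 * (3 * 11848200 / 2030) : ℝ)
  refine HasDerivAt.congr_deriv (f := G) (h1.add h2) ?_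
  unfold dG x y
  simp only [Pi.pow_apply]
  norm_num
  ring

lemma cont_x : Continuous x :=
  continuous_iff_continuousAt.2 fun t => (hasDerivAt_x t).continuousAt
lemma cont_y : Continuous y :=
  continuous_iff_continuousAt.2 fun t => (hasDerivAt_y t).continuousAt
lemma cont_F : Continuous F :=
  continuous_iff_continuousAt.2 fun t => (hasDerivAt_F t).continuousAt

lemma cont_dG : Continuous dG := by
  unfold dG
  have := cont_r
  have := cont_w
  have := cont_x
  have := cont_y
  fun_prop

/-- integrand of `A`. -/
noncomputable def a (t : ℝ) : ℝ := Real.cos t ^ 36 * w t * r t ^ 77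

/-- integrand of `B`. -/
noncomputable def b (t : ℝ) : ℝ := Real.cos t ^ 28 * Real.sin t * w t * r t ^ 64 * F t

lemma cont_a : Continuous a := by
  unfold a
  have := cont_r
  have := cont_w
  fun_prop

lemma cont_b : Continuous b := by
  unfold b
  have := cont_r
  have := cont_w
  have := cont_F
  fun_prop

lemma key_eq (t : ℝ) : 575803 * a t - 11848200 * b t - dG t =
    11848200 * (Real.cos t ^ 28 * w t * r t ^ 64 * (Real.sin t * g t))
    + a t * (575803 - 73 / 70 * (11848200 / 29) * x t ^ 4) := by
  have h : y t ^ 4 = 1 - x t ^ 6 := by linarith [xy t]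
  have e1 : a t = Real.cos t ^ 5 * r t ^ 15 * w t * x t ^ 31 := by
    unfold a x; ring
  have e2 : Real.cos t ^ 28 * w t * r t ^ 64 * (Real.sin t * y t ^ 3)
      = Real.cos t ^ 5 * r t ^ 15 * w t * (x t ^ 23 * y t ^ 4) := by
    unfold x y; ring
  have e3 : Real.cos t ^ 28 * w t * r t ^ 64 * (Real.sin t * g t)
      = 2 / 3 * (Real.cos t ^ 5 * r t ^ 15 * w t * (x t ^ 23 * y t ^ 4)) - b t := by
    rw [← e2]; unfold g b; ring
  rw [e3, e1]
  unfold dG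
  rw [h]
  ring

lemma key_pos : 0 < ∫ t in (0 : ℝ)..(2 * π), (575803 * a t - 11848200 * b t - dG t) := by
  have ca := cont_a
  have cb := cont_b
  have cG := cont_dG
  have hx4 : ∀ t, 0 < 575803 - 73 / 70 * (11848200 / 29) * x t ^ 4 := fun t => by
    have h1 := x_sq_le t
    have h2 : x t ^ 4 ≤ 1 := by
      calc x t ^ 4 = (x t ^ 2) ^ 2 := by ring
        _ ≤ 1 := pow_le_one₀ (by positivity) h1
    linarith
  refine intervalIntegral.integral_pos (by linarith [Real.pi_pos])
    (Continuous.continuousOn (by fun_prop)) ?_ ⟨0, ⟨le_rfl, by linarith [Real.pi_pos]⟩, ?_⟩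
  · intro t ht
    rw [key_eq]
    have h1 := sin_mul_g t ht.1.le ht.2
    have h2 := w_nonneg t
    have h3 := r_pos t
    have h4 := hx4 t
    have h5 : 0 ≤ a t := by unfold a; positivity
    have h6 : 0 ≤ Real.cos t ^ 28 := by positivity
    have h7 : 0 ≤ Real.cos t ^ 28 * w t * r t ^ 64 * (Real.sin t * g t) :=
      mul_nonneg (by positivity) h1
    have h8 := mul_nonneg h5 h4.le
    linarith
  · rw [key_eq]
    have h3 := r_pos 0
    have h5 : 0 < a 0 := by
      unfold a w
      simp only [Real.cos_zero, Real.sin_zero]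
      positivity
    have h8 := mul_pos h5 (hx4 0)
    simp only [Real.sin_zero, zero_mul, mul_zero, zero_add]
    exact h8

lemma int_dG : ∫ t in (0 : ℝ)..(2 * π), dG t = 0 := by
  rw [intervalIntegral.integral_eq_sub_of_hasDerivAt (fun t _ => hasDerivAt_G t)
    (cont_dG.intervalIntegrable _ _)]
  simp [G, y]

lemma main : 0 < 575803 * (∫ t in (0 : ℝ)..(2 * π), a t)
    - 11848200 * ∫ t in (0 : ℝ)..(2 * π), b t := by
  have h := key_pos
  have ia := (cont_a.intervalIntegrable (μ := MeasureTheory.volume) 0 (2 * π)).const_mul 575803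
  have ib := (cont_b.intervalIntegrable (μ := MeasureTheory.volume) 0 (2 * π)).const_mul 11848200
  rw [intervalIntegral.integral_sub (ia.sub ib) (cont_dG.intervalIntegrable _ _),
    intervalIntegral.integral_sub ia ib, int_dG, intervalIntegral.integral_const_mul,
    intervalIntegral.integral_const_mul] at h
  linarith

end FocalAux

/-- with
`f₂(φ) = ∫₀^φ cos⁷ψ sin²ψ (2cos²ψ + 3sin²ψ)(cos⁶ψ + sin⁴ψ)^{−25/12} dψ`,
`A = ∫₀^{2π} cos³⁶φ (2cos²φ + 3sin²φ)(cos⁶φ + sin⁴φ)^{−77/12} dφ`, and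
`B = ∫₀^{2π} cos²⁸φ sin φ (2cos²φ + 3sin²φ)(cos⁶φ + sin⁴φ)^{−16/3} f₂(φ) dφ`,
one has `575803·A − 11848200·B > 0`. -/
theorem third_focal_value_constant_pos
    (f2 : ℝ → ℝ)
    (hf2 : ∀ φ : ℝ, f2 φ =
      ∫ ψ in (0:ℝ)..φ, Real.cos ψ ^ 7 * Real.sin ψ ^ 2 *
        (2 * Real.cos ψ ^ 2 + 3 * Real.sin ψ ^ 2) *
        (Real.cos ψ ^ 6 + Real.sin ψ ^ 4) ^ (-(25 : ℝ) / 12))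
    (A B : ℝ)
    (hA : A = ∫ φ in (0:ℝ)..(2 * π), Real.cos φ ^ 36 *
      (2 * Real.cos φ ^ 2 + 3 * Real.sin φ ^ 2) *
      (Real.cos φ ^ 6 + Real.sin φ ^ 4) ^ (-(77 : ℝ) / 12))
    (hB : B = ∫ φ in (0:ℝ)..(2 * π), Real.cos φ ^ 28 * Real.sin φ *
      (2 * Real.cos φ ^ 2 + 3 * Real.sin φ ^ 2) *
      (Real.cos φ ^ 6 + Real.sin φ ^ 4) ^ (-(16 : ℝ) / 3) * f2 φ) :
    0 < 575803 * A - 11848200 * B := by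
  have hF : ∀ φ, f2 φ = FocalAux.F φ := fun φ => by
    rw [hf2]
    unfold FocalAux.F
    congr 1
    funext t
    rw [FocalAux.rpow_eq t 25 _ (by norm_num)]
    rfl
  have hA' : A = ∫ t in (0 : ℝ)..(2 * π), FocalAux.a t := by
    rw [hA]
    congr 1
    funext t
    rw [FocalAux.rpow_eq t 77 _ (by norm_num)]
    rfl
  have hB' : B = ∫ t in (0 : ℝ)..(2 * π), FocalAux.b t := by
    rw [hB]
    congr 1
    funext t
    rw [FocalAux.rpow_eq t 64 _ (by norm_num), hF]
    rfl
  rw [hA', hB']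
  exact FocalAux.main
end
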